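/- If X ⊆ ℕ is loquaciously high for descending sequences, then every Π¹₁ subset of ℕ is c.e. in X. -/

import Mathlib

namespace CFT

open Nat.Partrec (Code)

/-- Relativized partial recursive functions: `f` is partial recursive in the
(total) oracle `O : ℕ → ℕ`.  This mirrors Mathlib's `Nat.Partrec`, with an
extra constructor for the oracle. -/
inductive RecursiveIn (O : ℕ → ℕ) : (ℕ →. ℕ) → Prop
  | zero : RecursiveIn O (pure 0)
  | succ : RecursiveIn O Nat.succ
  | left : RecursiveIn O ↑fun n : ℕ => n.unpair.1
  | right : RecursiveIn O ↑fun n : ℕ => n.unpair.2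
  | oracle : RecursiveIn O ↑O
  | pair {f g} : RecursiveIn O f → RecursiveIn O g →
      RecursiveIn O fun n => Nat.pair <$> f n <*> g n
  | comp {f g} : RecursiveIn O f → RecursiveIn O g →
      RecursiveIn O fun n => g n >>= f
  | prec {f g} : RecursiveIn O f → RecursiveIn O g →
      RecursiveIn O (Nat.unpaired fun a n =>
        n.rec (f a) fun y IH => do let i ← IH; g (Nat.pair a (Nat.pair y i)))
  | rfind {f} : RecursiveIn O f →
      RecursiveIn O fun a => Nat.rfind fun n => (fun m => m = 0) <$> f (Nat.pair a n)

/-- Partial functions between `Primcodable` types that are partial recursive in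
the oracle `O`. -/
def PartrecIn (O : ℕ → ℕ) {α σ : Type} [Primcodable α] [Primcodable σ] (f : α →. σ) : Prop :=
  RecursiveIn O fun n =>
    Part.bind (Part.ofOption (Encodable.decode (α := α) n)) fun a => (f a).map Encodable.encode

/-- Total functions between `Primcodable` types that are computable in the oracle `O`. -/
def ComputableIn (O : ℕ → ℕ) {α σ : Type} [Primcodable α] [Primcodable σ] (f : α → σ) : Prop :=
  PartrecIn O (f : α →. σ)

open Classical in
/-- The characteristic function of a set of naturals. -/
noncomputable def chi (A : Set ℕ) : ℕ → ℕ := fun n => if n ∈ A then 1 else 0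

/-- `A` is computably enumerable in (the characteristic function of) `X`. -/
def CEIn (X : Set ℕ) (A : Set ℕ) : Prop :=
  ∃ f : ℕ →. ℕ, PartrecIn (chi X) f ∧ ∀ n, n ∈ A ↔ (f n).Dom

/-- The `e`-th partial computable function `ℕ →. ℕ`. -/
def codeFn (e : ℕ) : ℕ →. ℕ := (Denumerable.ofNat Code e).eval

/-! ### Trees on ℕ -/

def PrefixClosed (T : Set (List ℕ)) : Prop := ∀ l ∈ T, ∀ l' : List ℕ, l' <+: l → l' ∈ T

/-- Index `e` decides a (prefix-closed) tree on `ℕ`. -/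
def DecidesTree (e : ℕ) : Prop :=
  (∀ n, (codeFn e n).Dom) ∧
    PrefixClosed {l : List ℕ | codeFn e (Encodable.encode l) = Part.some 1}

open Classical in
/-- The standard enumeration of computable trees on ℕ; indices that do not
decide a tree denote the empty tree. -/
noncomputable def treeAt (e : ℕ) : Set (List ℕ) :=
  if DecidesTree e then {l : List ℕ | codeFn e (Encodable.encode l) = Part.some 1} else ∅

/-- `f` is a path through the tree `T`: every finite initial segment
`[f 0, …, f (k-1)]` is in `T`. -/
def IsPath (T : Set (List ℕ)) (f : ℕ → ℕ) : Prop := ∀ k, (List.range k).map f ∈ T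

def IllFounded (T : Set (List ℕ)) : Prop := ∃ f, IsPath T f

/-- The set of indices of well-founded computable trees. -/
def WF : Set ℕ := {e | ¬ IllFounded (treeAt e)}

/-- `T` is a computable tree (prefix-closed and decided by a total computable function). -/
def ComputableTree (T : Set (List ℕ)) : Prop :=
  PrefixClosed T ∧ ∃ χ : List ℕ → Bool, Computable χ ∧ ∀ l, l ∈ T ↔ χ l = true

/-! ### Highness notions for paths -/

def HighForPaths (X : Set ℕ) : Prop :=
  ∀ T : Set (List ℕ), ComputableTree T → IllFounded T →
    ∃ f : ℕ → ℕ, ComputableIn (chi X) f ∧ IsPath T f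

def LoqHighForPaths (X : Set ℕ) : Prop :=
  ∃ F : ℕ × ℕ → ℕ, ComputableIn (chi X) F ∧
    ∀ e, IllFounded (treeAt e) → IsPath (treeAt e) fun n => F (e, n)

def UnifHighForPaths (X : Set ℕ) : Prop :=
  ∃ F : ℕ × ℕ →. ℕ, PartrecIn (chi X) F ∧
    ∀ e, IllFounded (treeAt e) →
      ∃ g : ℕ → ℕ, IsPath (treeAt e) g ∧ ∀ n, F (e, n) = Part.some (g n)

def RetHighForPaths (X : Set ℕ) : Prop :=
  ∃ F : ℕ × ℕ →. ℕ, PartrecIn (chi X) F ∧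
    (∀ e, IllFounded (treeAt e) →
      ∃ g : ℕ → ℕ, IsPath (treeAt e) g ∧ ∀ n, F (e, n) = Part.some (g n)) ∧
    (∀ e, ¬ IllFounded (treeAt e) → ∀ n, ¬ (F (e, n)).Dom)

/-! ### Σ¹₁ and Π¹₁ sets -/

def Sigma11 (A : Set ℕ) : Prop :=
  ∃ R : ℕ → List ℕ → Bool, Computable₂ R ∧
    ∀ n, n ∈ A ↔ ∃ f : ℕ → ℕ, ∀ k, R n ((List.range k).map f) = true

def Pi11 (A : Set ℕ) : Prop := Sigma11 Aᶜ

/-! ### Linear orders -/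

/-- A (presentation of a) linear order: a domain `D ⊆ ℕ` and a strict order
relation on it. -/
structure LinOrd where
  dom : Set ℕ
  lt : ℕ → ℕ → Prop

/-- `L` really is a strict linear order on its domain. -/
def LinOrd.IsValid (L : LinOrd) : Prop :=
  (∀ a b, L.lt a b → a ∈ L.dom ∧ b ∈ L.dom) ∧
  (∀ a, ¬ L.lt a a) ∧
  (∀ a b c, L.lt a b → L.lt b c → L.lt a c) ∧
  (∀ a ∈ L.dom, ∀ b ∈ L.dom, a = b ∨ L.lt a b ∨ L.lt b a)

def linOrdOfCodes (n : ℕ) : LinOrd :=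
  ⟨{a | codeFn n.unpair.1 a = Part.some 1},
   fun a b => codeFn n.unpair.2 (Nat.pair a b) = Part.some 1⟩

def DecidesLinOrd (n : ℕ) : Prop :=
  (∀ m, (codeFn n.unpair.1 m).Dom) ∧ (∀ m, (codeFn n.unpair.2 m).Dom) ∧
    (linOrdOfCodes n).IsValid

open Classical in
/-- The standard enumeration of computable linear orders; indices that do not
decide a linear order denote the empty order. -/
noncomputable def linOrdAt (n : ℕ) : LinOrd :=
  if DecidesLinOrd n then linOrdOfCodes n else ⟨∅, fun _ _ => False⟩

def IsDescSeq (L : LinOrd) (f : ℕ → ℕ) : Prop :=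
  ∀ i, f i ∈ L.dom ∧ L.lt (f (i + 1)) (f i)

def LinOrd.IllFounded (L : LinOrd) : Prop := ∃ f, IsDescSeq L f

/-- A tight descending sequence: a descending sequence that gets below every
descending sequence. -/
def IsTightDescSeq (L : LinOrd) (f : ℕ → ℕ) : Prop :=
  IsDescSeq L f ∧ ∀ g, IsDescSeq L g → ∀ n, ∃ m, L.lt (f m) (g n)

/-- `L` is a computable linear order. -/
def ComputableLinOrd (L : LinOrd) : Prop :=
  L.IsValid ∧
  (∃ χ : ℕ → Bool, Computable χ ∧ ∀ a, a ∈ L.dom ↔ χ a = true) ∧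
  (∃ χ : ℕ → ℕ → Bool, Computable₂ χ ∧ ∀ a b, L.lt a b ↔ χ a b = true)

def LoqHighForDS (X : Set ℕ) : Prop :=
  ∃ g : ℕ × ℕ → ℕ, ComputableIn (chi X) g ∧
    ∀ n, (linOrdAt n).IllFounded → IsDescSeq (linOrdAt n) fun k => g (n, k)

def HighForTightDS (X : Set ℕ) : Prop :=
  ∀ L : LinOrd, ComputableLinOrd L → L.IllFounded →
    ∃ f : ℕ → ℕ, ComputableIn (chi X) f ∧ IsTightDescSeq L f

def UnifHighForTightDS (X : Set ℕ) : Prop :=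
  ∃ F : ℕ × ℕ →. ℕ, PartrecIn (chi X) F ∧
    ∀ n, (linOrdAt n).IllFounded →
      ∃ g : ℕ → ℕ, IsTightDescSeq (linOrdAt n) g ∧ ∀ k, F (n, k) = Part.some (g k)

/-! ### Binary trees -/

def PrefixClosedB (B : Set (List Bool)) : Prop := ∀ l ∈ B, ∀ l' : List Bool, l' <+: l → l' ∈ B

def DecidesBTree (e : ℕ) : Prop :=
  (∀ n, (codeFn e n).Dom) ∧
    PrefixClosedB {l : List Bool | codeFn e (Encodable.encode l) = Part.some 1}

open Classical in
/-- The standard enumeration of computable binary trees; indices that do not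
decide a binary tree denote the full binary tree. -/
noncomputable def bTreeAt (e : ℕ) : Set (List Bool) :=
  if DecidesBTree e then {l : List Bool | codeFn e (Encodable.encode l) = Part.some 1}
  else Set.univ

def BInfinite (B : Set (List Bool)) : Prop := ∀ k, ∃ l ∈ B, l.length = k

def IsBPath (B : Set (List Bool)) (p : ℕ → Bool) : Prop := ∀ k, (List.range k).map p ∈ B


/-! ### The Kleene–Brouwer order -/

/-- A finite sequence padded with `⊤`, so that the lexicographic order on keys is the
Kleene–Brouwer order. -/
def kbKey (a : List ℕ) : Lex (ℕ → WithTop ℕ) :=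
  toLex fun i => if i < a.length then ((a.getD i 0 : ℕ) : WithTop ℕ) else ⊤

/-- The Kleene–Brouwer order: `a` lies below `b` if `a` properly extends `b` or is to the left
of `b` at the first difference. -/
def KBLt (a b : List ℕ) : Prop :=
  ∃ i < a.length, a.take i = b.take i ∧ (b.length ≤ i ∨ a.getD i 0 < b.getD i 0)

theorem kbKey_apply (a : List ℕ) (i : ℕ) :
    kbKey a i = if i < a.length then ((a.getD i 0 : ℕ) : WithTop ℕ) else ⊤ := rfl

theorem kbKey_apply_eq_iff (a b : List ℕ) (i : ℕ) : kbKey a i = kbKey b i ↔ a[i]? = b[i]? := by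
  by_cases ha : i < a.length <;> by_cases hb : i < b.length <;>
    simp [kbKey_apply, ha, hb]

theorem kbKey_injective : Function.Injective kbKey := fun a b h =>
  List.ext_getElem? fun i => (kbKey_apply_eq_iff a b i).1 (congrFun h i)

theorem take_eq_take_iff_kbKey (a b : List ℕ) (i : ℕ) :
    a.take i = b.take i ↔ ∀ j < i, kbKey a j = kbKey b j := by
  simp only [kbKey_apply_eq_iff]
  constructor
  · intro h j hj
    rw [← List.getElem?_take_of_lt hj, h, List.getElem?_take_of_lt hj]
  · intro h
    refine List.ext_getElem? fun j => ?_
    by_cases hj : j < i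
    · rw [List.getElem?_take_of_lt hj, List.getElem?_take_of_lt hj, h j hj]
    · simp [hj]

theorem kbLt_iff (a b : List ℕ) : KBLt a b ↔ kbKey a < kbKey b := by
  constructor
  · rintro ⟨i, hi, ht, h⟩
    refine ⟨i, (take_eq_take_iff_kbKey a b i).1 ht, ?_⟩
    change kbKey a i < kbKey b i
    by_cases hb : i < b.length
    · simpa [kbKey_apply, hi, hb] using h.resolve_left (by omega)
    · simp [kbKey_apply, hi, hb]
  · rintro ⟨i, ht, h⟩
    replace h : kbKey a i < kbKey b i := h
    have hi : i < a.length := by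
      by_contra hi
      simp [kbKey_apply, hi] at h
    refine ⟨i, hi, (take_eq_take_iff_kbKey a b i).2 ht, ?_⟩
    by_cases hb : i < b.length
    · right
      simpa [kbKey_apply, hi, hb] using h
    · exact .inl (by omega)

theorem primrecRel_kbLt : PrimrecRel KBLt := by
  have hR : PrimrecRel fun (i : ℕ) (p : List ℕ × List ℕ) =>
      p.1.take i = p.2.take i ∧ (p.2.length ≤ i ∨ p.1.getD i 0 < p.2.getD i 0) := by
    have ha : Primrec fun q : ℕ × (List ℕ × List ℕ) => q.2.1 := Primrec.fst.comp Primrec.snd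
    have hb : Primrec fun q : ℕ × (List ℕ × List ℕ) => q.2.2 := Primrec.snd.comp Primrec.snd
    have h₁ := Primrec.eq.comp (Primrec.list_take.comp Primrec.fst ha)
      (Primrec.list_take.comp Primrec.fst hb)
    have h₂ := Primrec.nat_le.comp (Primrec.list_length.comp hb) Primrec.fst
    have h₃ := Primrec.nat_lt.comp ((Primrec.list_getD 0).comp ha Primrec.fst)
      ((Primrec.list_getD 0).comp hb Primrec.fst)
    exact h₁.and (h₂.or h₃)
  have hex := hR.exists_mem_list.comp
    (Primrec.list_range.comp (Primrec.list_length.comp (Primrec.fst (α := List ℕ) (β := List ℕ))))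
    Primrec.id
  exact hex.of_eq fun p => by simp [KBLt]

theorem kbLt_map_range_succ (f : ℕ → ℕ) (k : ℕ) :
    KBLt ((List.range (k + 1)).map f) ((List.range k).map f) := by
  refine ⟨k, by simp, ?_, .inl (by simp)⟩
  simp [List.range_succ]

/-- The coordinates of a descending sequence for the lexicographic order on sequences over a
well-order stabilize. -/
theorem exists_limit_of_antitone {β : Type*} [LinearOrder β] [WellFoundedLT β]
    {s : ℕ → Lex (ℕ → β)} (hs : Antitone s) (k : ℕ) :
    ∃ N, ∀ i ≥ N, ∀ j < k, s i j = s N j := by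
  induction k with
  | zero => exact ⟨0, by simp⟩
  | succ k ih =>
    obtain ⟨N, hN⟩ := ih
    obtain ⟨M, hM, hmin⟩ := WellFounded.has_min (α := ℕ)
      (r := fun x y => s x k < s y k) (InvImage.wf _ wellFounded_lt) {i | N ≤ i} ⟨N, le_refl N⟩
    refine ⟨M, fun i hi => ?_⟩
    have hagree : ∀ j < k, s i j = s M j := fun j hj =>
      (hN i (le_trans hM hi) j hj).trans (hN M hM j hj).symm
    intro j hj
    rcases Nat.lt_succ_iff_lt_or_eq.1 hj with hj | rfl
    · exact hagree j hj
    · refine le_antisymm ?_ (not_lt.1 (hmin i (le_trans hM hi)))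
      by_contra hlt
      exact (hs hi).not_gt ⟨j, fun l hl => (hagree l hl).symm, not_le.1 hlt⟩

theorem illFounded_of_kbLt {T : Set (List ℕ)} (hT : PrefixClosed T) {s : ℕ → List ℕ}
    (hsT : ∀ i, s i ∈ T) (hs : ∀ i, KBLt (s (i + 1)) (s i)) : IllFounded T := by
  have hanti : StrictAnti fun i => kbKey (s i) :=
    strictAnti_nat_of_succ_lt fun i => (kbLt_iff _ _).1 (hs i)
  choose N hN using exists_limit_of_antitone hanti.antitone
  have hlen : ∀ k i, N (k + 1) ≤ i → k < (s i).length := by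
    intro k i hi
    by_contra hk
    have htake : (s i).take (k + 1) = (s (i + 1)).take (k + 1) :=
      (take_eq_take_iff_kbKey _ _ _).2 fun j hj =>
        (hN _ i hi j hj).trans (hN _ (i + 1) (by omega) j hj).symm
    have hl := congrArg List.length htake
    simp only [List.length_take] at hl
    rw [List.take_of_length_le (by omega), List.take_of_length_le (by omega)] at htake
    exact (hanti (Nat.lt_succ_self i)).ne (congrArg kbKey htake.symm)
  refine ⟨fun k => (s (N (k + 1))).getD k 0, fun k => ?_⟩
  refine hT _ (hsT (max (N k) (N (k + 1)))) _ ?_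
  rw [List.prefix_iff_eq_take]
  have hk := hlen k (max (N k) (N (k + 1))) (le_max_right _ _)
  have hstab : ∀ j < k, (s (max (N k) (N (k + 1))))[j]? = (s (N (j + 1)))[j]? := by
    intro j hj
    rw [← kbKey_apply_eq_iff]
    have h₁ := hN k (max (N k) (max (N (k + 1)) (N (j + 1)))) (le_max_left _ _) j hj
    have h₂ := hN k (max (N k) (N (k + 1))) (le_max_left _ _) j hj
    have h₃ := hN (j + 1) (max (N k) (max (N (k + 1)) (N (j + 1)))) (by omega) j (by omega)
    exact h₂.trans (h₁.symm.trans h₃)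
  refine List.ext_getElem? fun j => ?_
  by_cases hj : j < k
  · have hjl := hlen j (N (j + 1)) le_rfl
    simp [hj, hstab j hj, hjl]
  · simp [hj]

/-- The Kleene–Brouwer order on the codes of the elements of `T`. -/
def kbOrder (T : Set (List ℕ)) : LinOrd where
  dom := {a | Denumerable.ofNat (List ℕ) a ∈ T}
  lt a b := Denumerable.ofNat (List ℕ) a ∈ T ∧ Denumerable.ofNat (List ℕ) b ∈ T ∧
    KBLt (Denumerable.ofNat (List ℕ) a) (Denumerable.ofNat (List ℕ) b)

theorem kbOrder_isValid (T : Set (List ℕ)) : (kbOrder T).IsValid := by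
  refine ⟨fun a b h => ⟨h.1, h.2.1⟩, fun a h => ?_, fun a b c hab hbc => ?_, fun a ha b hb => ?_⟩
  · exact lt_irrefl _ ((kbLt_iff _ _).1 h.2.2)
  · exact ⟨hab.1, hbc.2.1, (kbLt_iff _ _).2
      (((kbLt_iff _ _).1 hab.2.2).trans ((kbLt_iff _ _).1 hbc.2.2))⟩
  · rcases lt_trichotomy (kbKey (Denumerable.ofNat (List ℕ) a))
      (kbKey (Denumerable.ofNat (List ℕ) b)) with h | h | h
    · exact .inr (.inl ⟨ha, hb, (kbLt_iff _ _).2 h⟩)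
    · exact .inl ((Denumerable.eqv (List ℕ)).symm.injective (kbKey_injective h))
    · exact .inr (.inr ⟨hb, ha, (kbLt_iff _ _).2 h⟩)

theorem kbOrder_illFounded_iff {T : Set (List ℕ)} (hT : PrefixClosed T) :
    (kbOrder T).IllFounded ↔ IllFounded T := by
  constructor
  · rintro ⟨s, hs⟩
    exact illFounded_of_kbLt (s := fun i => Denumerable.ofNat (List ℕ) (s i)) hT
      (fun i => (hs i).1) fun i => (hs i).2.2.2
  · rintro ⟨f, hf⟩
    refine ⟨fun k => Encodable.encode ((List.range k).map f), fun k => ?_⟩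
    simp only [kbOrder, Set.mem_ofPred_eq, Denumerable.ofNat_encode]
    exact ⟨hf k, hf (k + 1), hf k, kbLt_map_range_succ f k⟩

theorem isDescSeq_iff {L : LinOrd} (hL : L.IsValid) (f : ℕ → ℕ) :
    IsDescSeq L f ↔ ∀ i, L.lt (f (i + 1)) (f i) :=
  ⟨fun h i => (h i).2, fun h i => ⟨(hL.1 _ _ (h i)).2, h i⟩⟩

/-! ### The tree of approximations to a Σ¹₁ set -/

/-- The finite sequences all of whose initial segments satisfy `r`. -/
def hereditary (r : List ℕ → Bool) : Set (List ℕ) := {l | ∀ k, r (l.take k) = true}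

theorem hereditary_prefixClosed (r : List ℕ → Bool) : PrefixClosed (hereditary r) := by
  intro l hl l' hl' k
  rw [List.prefix_iff_eq_take.1 hl', List.take_take]
  exact hl _

theorem illFounded_hereditary_iff (r : List ℕ → Bool) :
    IllFounded (hereditary r) ↔ ∃ f : ℕ → ℕ, ∀ k, r ((List.range k).map f) = true := by
  refine exists_congr fun f => ⟨fun h k => ?_, fun h k m => ?_⟩
  · simpa [List.take_of_length_le] using h k k
  · rw [← List.map_take, List.take_range]
    exact h _

theorem computablePred_hereditary {R : ℕ → List ℕ → Bool} (hR : Computable₂ R) :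
    ComputablePred fun p : ℕ × List ℕ => p.2 ∈ hereditary (R p.1) := by
  have hstep : Computable₂ fun (p : ℕ × List ℕ) (q : ℕ × Bool) =>
      q.2 && R p.1 (p.2.take q.1) :=
    Primrec.and.to_comp.comp (Computable.snd.comp Computable.snd)
      (hR.comp (Computable.fst.comp Computable.fst)
        (Primrec.list_take.to_comp.comp (Computable.fst.comp Computable.snd)
          (Computable.snd.comp Computable.fst)))
  have hrec := Computable.nat_rec
    (Computable.succ.comp (Computable.list_length.comp Computable.snd))
    (Computable.const true) hstep
  refine ComputablePred.computable_iff.2 ⟨_, hrec, funext fun p => propext ?_⟩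
  have key : ∀ n, (Nat.rec (motive := fun _ => Bool) true
      (fun y IH => IH && R p.1 (p.2.take y)) n = true) ↔ ∀ k < n, R p.1 (p.2.take k) = true := by
    intro n
    induction n with
    | zero => simp
    | succ n ih =>
      rw [Nat.forall_lt_succ_right, ← ih]
      simp
  refine Iff.trans ⟨fun h k _ => h k, fun h k => ?_⟩ (key (p.2.length + 1)).symm
  by_cases hk : k < p.2.length + 1
  · exact h k hk
  · have := h p.2.length (by omega)
    rw [List.take_length] at this
    rwa [List.take_of_length_le (by omega)]

theorem computablePred_preimage {α β : Type*} [Primcodable α] [Primcodable β] {p : β → Prop}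
    (hp : ComputablePred p) {u : α → β} (hu : Computable u) : ComputablePred fun a => p (u a) := by
  obtain ⟨b, hb, rfl⟩ := ComputablePred.computable_iff.1 hp
  exact ComputablePred.computable_iff.2 ⟨_, hb.comp hu, rfl⟩

theorem computablePred_and {α : Type*} [Primcodable α] {p q : α → Prop}
    (hp : ComputablePred p) (hq : ComputablePred q) : ComputablePred fun a => p a ∧ q a := by
  obtain ⟨b, hb, rfl⟩ := ComputablePred.computable_iff.1 hp
  obtain ⟨c, hc, rfl⟩ := ComputablePred.computable_iff.1 hq
  exact ComputablePred.computable_iff.2 ⟨_, Primrec.and.to_comp.comp hb hc, by simp⟩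

/-! ### Indices for uniformly computable families of linear orders -/

/-- The `0`/`1`-valued indicator of a computable predicate on `ℕ × ℕ` has an index uniformly in
the first coordinate. -/
theorem exists_index_of_computablePred {P : ℕ → ℕ → Prop}
    (hP : ComputablePred fun q : ℕ × ℕ => P q.1 q.2) :
    ∃ c : ℕ → ℕ, Computable c ∧ ∀ n a, (codeFn (c n) a).Dom ∧
      (codeFn (c n) a = Part.some 1 ↔ P n a) := by
  obtain ⟨b, hb, hPb⟩ := ComputablePred.computable_iff.1 hP
  have hcomp : Computable fun m : ℕ => (b m.unpair).toNat :=
    (Primrec.dom_bool Bool.toNat).to_comp.comp (hb.comp Computable.unpair)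
  obtain ⟨d, hd⟩ := Code.exists_code.1 (Partrec.nat_iff.1 hcomp.partrec)
  refine ⟨fun n => Encodable.encode (d.curry n), Computable.encode.comp
    (Code.primrec₂_curry.to_comp.comp (Computable.const d) Computable.id), fun n a => ?_⟩
  have heval : codeFn (Encodable.encode (d.curry n)) a = Part.some (b (n, a)).toNat := by
    simp [codeFn, Code.eval_curry, hd]
  rw [heval]
  refine ⟨trivial, ?_⟩
  have : P n a ↔ b (n, a) = true := iff_of_eq (congrFun hPb (n, a))
  rw [this]
  cases b (n, a) <;> simp

theorem exists_linOrdAt_eq {L : ℕ → LinOrd} (hL : ∀ n, (L n).IsValid)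
    (hdom : ComputablePred fun q : ℕ × ℕ => q.2 ∈ (L q.1).dom)
    (hlt : ComputablePred fun q : ℕ × ℕ => (L q.1).lt q.2.unpair.1 q.2.unpair.2) :
    ∃ c : ℕ → ℕ, Computable c ∧ ∀ n, linOrdAt (c n) = L n := by
  obtain ⟨c, hc, hcs⟩ := exists_index_of_computablePred (P := fun n a => a ∈ (L n).dom) hdom
  obtain ⟨d, hd, hds⟩ := exists_index_of_computablePred
    (P := fun n a => (L n).lt a.unpair.1 a.unpair.2) hlt
  refine ⟨fun n => Nat.pair (c n) (d n), Primrec₂.natPair.to_comp.comp hc hd, fun n => ?_⟩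
  have heq : linOrdOfCodes (Nat.pair (c n) (d n)) = L n := by
    have h₁ : {a | codeFn (c n) a = Part.some 1} = (L n).dom := Set.ext fun a => (hcs n a).2
    have h₂ : (fun a b => codeFn (d n) (Nat.pair a b) = Part.some 1) = (L n).lt := by
      funext a b
      simpa using (hds n (Nat.pair a b)).2
    simp only [linOrdOfCodes, Nat.unpair_pair, h₁, h₂]
  rw [linOrdAt, if_pos, heq]
  refine ⟨fun m => ?_, fun m => ?_, heq ▸ hL n⟩
  · simpa using (hcs n m).1
  · simpa using (hds n m).1

/-! ### Relativized computability -/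

theorem RecursiveIn.of_eq {O : ℕ → ℕ} {f g : ℕ →. ℕ} (hf : RecursiveIn O f)
    (h : ∀ n, f n = g n) : RecursiveIn O g :=
  (funext h : f = g) ▸ hf

theorem RecursiveIn.of_partrec {O : ℕ → ℕ} {f : ℕ →. ℕ} (hf : Nat.Partrec f) :
    RecursiveIn O f := by
  induction hf with
  | zero => exact .zero
  | succ => exact .succ
  | left => exact .left
  | right => exact .right
  | pair _ _ ih₁ ih₂ => exact .pair ih₁ ih₂
  | comp _ _ ih₁ ih₂ => exact .comp ih₁ ih₂
  | prec _ _ ih₁ ih₂ => exact .prec ih₁ ih₂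
  | rfind _ ih => exact .rfind ih

theorem RecursiveIn.of_computable {O : ℕ → ℕ} {f : ℕ → ℕ} (hf : Computable f) :
    RecursiveIn O f :=
  .of_partrec (Partrec.nat_iff.1 hf.partrec)

theorem RecursiveIn.comp_total {O f g : ℕ → ℕ} (hf : RecursiveIn O f) (hg : RecursiveIn O g) :
    RecursiveIn O ↑fun n => f (g n) :=
  (RecursiveIn.comp hf hg).of_eq fun n => Part.bind_some (g n) (f : ℕ →. ℕ)

theorem RecursiveIn.pair_total {O f g : ℕ → ℕ} (hf : RecursiveIn O f) (hg : RecursiveIn O g) :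
    RecursiveIn O ↑fun n => Nat.pair (f n) (g n) :=
  (RecursiveIn.pair hf hg).of_eq fun n => by simp [Seq.seq]

theorem ComputableIn.recursiveIn_unpair {O : ℕ → ℕ} {g : ℕ × ℕ → ℕ} (hg : ComputableIn O g) :
    RecursiveIn O ↑fun m : ℕ => g m.unpair :=
  RecursiveIn.of_eq hg fun n => by simp

theorem ceIn_of_exists_eq_zero {X A : Set ℕ} {t : ℕ → ℕ} (ht : RecursiveIn (chi X) t)
    (hA : ∀ n, n ∈ A ↔ ∃ i, t (Nat.pair n i) = 0) : CEIn X A := by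
  refine ⟨fun n => Nat.rfind fun i => (fun m => m = 0) <$> (t : ℕ →. ℕ) (Nat.pair n i),
    ?_, fun n => (hA n).trans ?_⟩
  · exact (RecursiveIn.rfind ht).of_eq fun n => by simp [Part.map_id']
  · refine Iff.trans ?_ Nat.rfind_dom.symm
    simp

/-- For a uniformly computable sequence of linear orders, those that are well-founded form a
c.e. set relative to a loquaciously high set. -/
theorem LoqHighForDS.ceIn_not_illFounded {X : Set ℕ} (h : LoqHighForDS X) {L : ℕ → LinOrd}
    (hL : ∀ n, (L n).IsValid)
    (hdom : ComputablePred fun q : ℕ × ℕ => q.2 ∈ (L q.1).dom)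
    (hlt : ComputablePred fun q : ℕ × ℕ => (L q.1).lt q.2.unpair.1 q.2.unpair.2) :
    CEIn X {n | ¬ (L n).IllFounded} := by
  obtain ⟨g, hg, hdesc⟩ := h
  obtain ⟨c, hc, hcL⟩ := exists_linOrdAt_eq hL hdom hlt
  obtain ⟨b, hb, hb_iff⟩ := ComputablePred.computable_iff.1 hlt
  have hb_lt : ∀ n x y, (L n).lt x y ↔ b (n, Nat.pair x y) = true := fun n x y => by
    simpa using iff_of_eq (congrFun hb_iff (n, Nat.pair x y))
  have hfst : Computable fun m : ℕ => m.unpair.1 := Computable.fst.comp Computable.unpair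
  have hsnd : Computable fun m : ℕ => m.unpair.2 := Computable.snd.comp Computable.unpair
  have hcur : RecursiveIn (chi X) ↑fun m : ℕ => Nat.pair (c m.unpair.1) m.unpair.2 :=
    .of_computable (Primrec₂.natPair.to_comp.comp (hc.comp hfst) hsnd)
  have hnext : RecursiveIn (chi X) ↑fun m : ℕ => Nat.pair (c m.unpair.1) (m.unpair.2 + 1) :=
    .of_computable (Primrec₂.natPair.to_comp.comp (hc.comp hfst) (Computable.succ.comp hsnd))
  have htest : RecursiveIn (chi X) ↑fun m : ℕ => (b m.unpair).toNat :=
    .of_computable ((Primrec.dom_bool Bool.toNat).to_comp.comp (hb.comp Computable.unpair))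
  have hg' := hg.recursiveIn_unpair
  refine ceIn_of_exists_eq_zero (htest.comp_total ((RecursiveIn.of_computable hfst).pair_total
    ((hg'.comp_total hnext).pair_total (hg'.comp_total hcur)))) fun n => ?_
  have hiff : (L n).IllFounded ↔ ∀ i, (L n).lt (g (c n, i + 1)) (g (c n, i)) := by
    rw [← isDescSeq_iff (hL n) fun k => g (c n, k)]
    refine ⟨fun hn => ?_, fun hn => ⟨_, hn⟩⟩
    have := hdesc (c n)
    rw [hcL] at this
    exact this hn
  simp [hiff, hb_lt]

/-- If `X` is loquaciously high for descending sequences, then every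
Π¹₁ subset of ℕ is c.e. in `X`. -/
theorem loqHighForDS_enumerates_Pi11 (X : Set ℕ) (h : LoqHighForDS X) :
    ∀ A : Set ℕ, Pi11 A → CEIn X A := by
  rintro A ⟨R, hR, hA⟩
  have hmem := computablePred_hereditary hR
  have hofNat : Computable (Denumerable.ofNat (List ℕ)) := Computable.ofNat _
  have hpull : ∀ {u : ℕ × ℕ → ℕ}, Computable u → ComputablePred fun q : ℕ × ℕ =>
      Denumerable.ofNat (List ℕ) (u q) ∈ hereditary (R q.1) := fun hu =>
    computablePred_preimage hmem (Computable.fst.pair (hofNat.comp hu))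
  have hfst : Computable fun q : ℕ × ℕ => q.2.unpair.1 :=
    Computable.fst.comp (Computable.unpair.comp Computable.snd)
  have hsnd : Computable fun q : ℕ × ℕ => q.2.unpair.2 :=
    Computable.snd.comp (Computable.unpair.comp Computable.snd)
  have hkb : ComputablePred fun q : ℕ × ℕ =>
      KBLt (Denumerable.ofNat (List ℕ) q.2.unpair.1) (Denumerable.ofNat (List ℕ) q.2.unpair.2) :=
    computablePred_preimage primrecRel_kbLt.computablePred ((hofNat.comp hfst).pair (hofNat.comp hsnd))
  convert h.ceIn_not_illFounded (L := fun n => kbOrder (hereditary (R n)))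
    (fun n => kbOrder_isValid _) (hpull Computable.snd)
    (computablePred_and (hpull hfst) (computablePred_and (hpull hsnd) hkb)) using 1
  ext n
  rw [Set.mem_ofPred_eq, kbOrder_illFounded_iff (hereditary_prefixClosed _),
    illFounded_hereditary_iff, ← hA n, Set.mem_compl_iff, not_not]

end CFT
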